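/- arXiv:1710.10966 — 6 statements merged into one kernel-verified Lean document; each statement's English description precedes it below -/
import Mathlib

section
/- The determinant of the matrix A(p,n,d,u) equals 1 if n = 1; equals d^{(p-1)(n-1)} if n ≥ 2 and d < p; and equals 0 if n ≥ 2 and d ≥ p. -/
/-- The regular representation of a finite group by permutation matrices. -/
noncomputable def regularRepMatrix (G : Type*) [Group G] [Fintype G] [DecidableEq G] :
    G →* Matrix G G ℤ where
  toFun g := Matrix.of fun x y => if y = x * g then 1 else 0
  map_one' := by
    ext x y
    simp [Matrix.one_apply, eq_comm]
  map_mul' g h := by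
    ext x y
    simp only [Matrix.mul_apply, Matrix.of_apply]
    rw [Finset.sum_eq_single (x * g)] <;> simp +contextual [mul_assoc]

theorem regularRepMatrix_apply {G : Type*} [Group G] [Fintype G] [DecidableEq G] (g x y : G) :
    regularRepMatrix G g x y = if y = x * g then 1 else 0 := rfl

open Polynomial in
theorem charpoly_regularRepMatrix {G : Type*} [Group G] [Fintype G] [DecidableEq G] (g : G)
    (hg : orderOf g = Fintype.card G) :
    (regularRepMatrix G g).charpoly = X ^ Fintype.card G - 1 := by
  set T := regularRepMatrix G g with hT
  have hpos : 0 < Fintype.card G := Fintype.card_pos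
  have hmonic : (X ^ Fintype.card G - 1 : ℤ[X]).Monic := monic_X_pow_sub_C 1 hpos.ne'
  have hdeg' : (X ^ Fintype.card G - 1 : ℤ[X]).natDegree = Fintype.card G :=
    natDegree_X_pow_sub_C (r := (1 : ℤ))
  have hlt : (T.charpoly - (X ^ Fintype.card G - 1)).degree < (Fintype.card G : WithBot ℕ) := by
    have h1 : T.charpoly.degree = Fintype.card G := T.charpoly_degree_eq_dim
    rw [← h1]
    refine degree_sub_lt_left ?_ T.charpoly_monic.ne_zero ?_
    · rw [h1, degree_eq_natDegree hmonic.ne_zero, hdeg']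
    · rw [T.charpoly_monic.leadingCoeff, hmonic.leadingCoeff]
  have hzero : aeval T (T.charpoly - (X ^ Fintype.card G - 1)) = 0 := by
    have h2 : T ^ Fintype.card G = 1 := by
      rw [hT, ← map_pow, pow_card_eq_one, map_one]
    simp [Matrix.aeval_self_charpoly, h2]
  rw [← sub_eq_zero]
  generalize T.charpoly - (X ^ Fintype.card G - 1) = q at hlt hzero
  ext k
  rw [coeff_zero]
  by_cases hk : k < Fintype.card G
  · have hentry := congrFun (congrFun hzero 1) (g ^ k)
    have hq : q.natDegree < Fintype.card G := by
      by_cases h0 : q = 0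
      · simpa [h0] using hpos
      · exact (natDegree_lt_iff_degree_lt h0).2 hlt
    rw [aeval_eq_sum_range' hq, Matrix.sum_apply] at hentry
    rw [Finset.sum_eq_single k] at hentry
    · simpa [hT, ← map_pow, regularRepMatrix_apply] using hentry
    · intro b hb hbk
      have : g ^ k ≠ g ^ b := fun h => hbk <|
        (pow_injOn_Iio_orderOf (by simpa [hg] using hk)
          (by simpa [hg] using hb) h).symm
      simp [hT, ← map_pow, regularRepMatrix_apply, this]
    · simp [hk]
  · exact coeff_eq_zero_of_degree_lt (hlt.trans_le (by exact_mod_cast not_lt.1 hk))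

open Polynomial in
theorem det_sum_pow_regularRepMatrix {G : Type*} [Group G] [Fintype G] [DecidableEq G] (g : G)
    (hg : orderOf g = Fintype.card G) (d : ℕ) (hd : (Fintype.card G).Coprime d) :
    (∑ k ∈ Finset.range d, regularRepMatrix G g ^ k).det = d := by
  set T := regularRepMatrix G g with hT
  set N := Fintype.card G with hN
  have hpos : 0 < N := Fintype.card_pos
  have hT1 : T.charpoly = X ^ N - 1 := charpoly_regularRepMatrix g hg
  have hTd : (T ^ d).charpoly = X ^ N - 1 := by
    rw [hT, ← map_pow]
    exact charpoly_regularRepMatrix _ (by rw [Nat.Coprime.orderOf_pow (hg ▸ hd), hg])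
  let S : Matrix G G ℤ[X] := Matrix.scalar G X
  let P : Matrix G G ℤ[X] := (C : ℤ →+* ℤ[X]).mapMatrix T
  have hcomm : Commute S P := Matrix.scalar_commute _ (fun _ => Commute.all _ _) _
  have hgeom := congrArg Matrix.det (hcomm.mul_geom_sum₂ d)
  have h1 : (S - P).det = X ^ N - 1 := hT1
  have h2 : (S ^ d - P ^ d).det = X ^ (d * N) - 1 := by
    have h3 := congrArg (fun q : ℤ[X] => q.comp (X ^ d)) hTd
    have hS : S ^ d = Matrix.scalar G (X ^ d) := (map_pow _ _ _).symm
    have hP : P ^ d = (C : ℤ →+* ℤ[X]).mapMatrix (T ^ d) := (map_pow _ _ _).symm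
    have h4 : (S ^ d - P ^ d) =
        ((compRingHom (X ^ d : ℤ[X])).mapMatrix (T ^ d).charmatrix) := by
      rw [hS, hP]
      ext i j : 1
      simp only [Matrix.charmatrix, RingHom.mapMatrix_apply, Matrix.map_apply,
        Matrix.sub_apply, Matrix.scalar_apply, Matrix.diagonal_apply]
      split_ifs <;> simp
    rw [h4, ← RingHom.map_det]
    have h5 : ((T ^ d).charmatrix.det).comp (X ^ d) = X ^ (d * N) - 1 := by
      simpa [Matrix.charpoly, ← pow_mul] using h3
    exact h5
  rw [Matrix.det_mul, h1, h2] at hgeom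
  have hne : (X ^ N - 1 : ℤ[X]) ≠ 0 := (monic_X_pow_sub_C 1 hpos.ne').ne_zero
  have h6 : (X ^ N - 1 : ℤ[X]) * ∑ j ∈ Finset.range d, (X ^ N) ^ j = X ^ (d * N) - 1 := by
    rw [mul_geom_sum, ← pow_mul, mul_comm N d]
  have h7 := congrArg (evalRingHom (1 : ℤ)) (mul_left_cancel₀ hne (hgeom.trans h6.symm))
  rw [RingHom.map_det] at h7
  have h8 : (evalRingHom (1 : ℤ)).mapMatrix S = 1 := by
    ext i j : 1
    simp only [S, RingHom.mapMatrix_apply, Matrix.map_apply, Matrix.scalar_apply,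
      Matrix.diagonal_apply, Matrix.one_apply]
    split_ifs <;> simp
  have h9 : (evalRingHom (1 : ℤ)).mapMatrix P = T := by
    ext i j : 1
    simp [P]
  rw [map_sum] at h7
  simp only [map_mul, map_pow, h8, h9, one_pow, one_mul] at h7
  rw [Finset.sum_range_reflect (fun k => T ^ k) d] at h7
  simpa [eval_finsetSum] using h7

open scoped Classical in
/-- The `0`-`1` matrix whose row `x` is supported on `x, x * g, …, x * g ^ (d - 1)`. -/
noncomputable def powMatrix {M : Type*} [Monoid M] (g : M) (d : ℕ) : Matrix M M ℤ :=
  Matrix.of fun x y => if ∃ k < d, y = x * g ^ k then 1 else 0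

theorem powMatrix_apply {M : Type*} [Monoid M] (g : M) (d : ℕ) (x y : M)
    [Decidable (∃ k < d, y = x * g ^ k)] :
    powMatrix g d x y = if ∃ k < d, y = x * g ^ k then 1 else 0 := by
  simp only [powMatrix, Matrix.of_apply]
  congr

theorem powMatrix_eq_one {M : Type*} [Monoid M] [DecidableEq M] (g : M) {d : ℕ} (hd : 1 ≤ d)
    (h : ∀ k < d, g ^ k = 1) : powMatrix g d = 1 := by
  classical
  ext x y
  rw [powMatrix_apply, Matrix.one_apply]
  refine if_congr ⟨?_, ?_⟩ rfl rfl
  · rintro ⟨k, hk, rfl⟩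
    rw [h k hk, mul_one]
  · rintro rfl
    exact ⟨0, hd, by simp⟩

theorem powMatrix_eq_sum {G : Type*} [Group G] [Fintype G] [DecidableEq G] (g : G) (d : ℕ)
    (hd : d ≤ orderOf g) :
    powMatrix g d = ∑ k ∈ Finset.range d, regularRepMatrix G g ^ k := by
  ext x y
  rw [powMatrix_apply, Matrix.sum_apply]
  simp only [← map_pow, regularRepMatrix_apply]
  split_ifs with h
  · obtain ⟨k, hk, rfl⟩ := h
    rw [Finset.sum_eq_single_of_mem k (Finset.mem_range.2 hk), if_pos rfl]
    intro b hb hbk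
    refine if_neg fun h => hbk ?_
    exact (pow_injOn_Iio_orderOf (hk.trans_le hd)
      ((Finset.mem_range.1 hb).trans_le hd) (mul_left_cancel h)).symm
  · refine (Finset.sum_eq_zero fun k hk => if_neg fun hy => h ⟨k, Finset.mem_range.1 hk, hy⟩).symm

theorem det_powMatrix_group {G : Type*} [Group G] [Fintype G] [DecidableEq G] (g : G) (d : ℕ)
    (hd : d ≤ orderOf g) (hcop : (orderOf g).Coprime d) :
    (powMatrix g d).det = (d : ℤ) ^ (Subgroup.zpowers g).index := by
  classical
  let H := Subgroup.zpowers g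
  let f : H × (G ⧸ H) → G := fun a => a.2.out * a.1
  have hmk (a : H × (G ⧸ H)) : ((f a : G) : G ⧸ H) = a.2 := by
    rw [QuotientGroup.mk_mul_of_mem _ a.1.2, QuotientGroup.out_eq']
  have hf : Function.Bijective f := by
    constructor
    · rintro a b hab
      have h2 : a.2 = b.2 := by rw [← hmk a, ← hmk b, hab]
      refine Prod.ext (Subtype.ext ?_) h2
      simpa [f, h2] using hab
    · intro x
      obtain ⟨h, hh⟩ := QuotientGroup.mk_out_eq_mul H x
      exact ⟨(h⁻¹, x), by simp [f, hh]⟩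
  let g' : H := ⟨g, Subgroup.mem_zpowers g⟩
  have horder : orderOf g' = orderOf g := Subgroup.orderOf_mk g _
  have hcard : orderOf g' = Fintype.card H := by
    rw [horder, ← Nat.card_eq_fintype_card, Nat.card_zpowers]
  have hblock : (powMatrix g d).submatrix (Equiv.ofBijective f hf) (Equiv.ofBijective f hf) =
      Matrix.blockDiagonal fun _ : G ⧸ H => powMatrix g' d := by
    ext a b
    rw [Matrix.submatrix_apply, Matrix.blockDiagonal_apply, powMatrix_apply, powMatrix_apply]
    simp only [Equiv.ofBijective_apply]
    split_ifs with h1 h2 h3 h2 h3 <;> try rfl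
    · exfalso
      obtain ⟨k, hk, h⟩ := h1
      refine h3 ⟨k, hk, Subtype.ext ?_⟩
      simpa [f, h2, mul_assoc, g'] using h
    · exfalso
      obtain ⟨k, hk, h⟩ := h1
      apply h2
      have hb : f b = f a * g ^ k := h
      rw [← hmk a, ← hmk b, hb,
        QuotientGroup.mk_mul_of_mem (f a) (Subgroup.npow_mem_zpowers g k)]
    · exfalso
      obtain ⟨k, hk, h⟩ := h3
      refine h1 ⟨k, hk, ?_⟩
      simp [f, h2, h, mul_assoc, g']
  rw [← Matrix.det_submatrix_equiv_self (Equiv.ofBijective f hf), hblock,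
    Matrix.det_blockDiagonal, powMatrix_eq_sum g' d (horder ▸ hd),
    det_sum_pow_regularRepMatrix g' hcard d (by rw [← hcard, horder]; exact hcop),
    Finset.prod_const, Finset.card_univ, ← Nat.card_eq_fintype_card, Subgroup.index]

open scoped Classical in
theorem det_powMatrix_units {M : Type*} [Monoid M] [Fintype M] [DecidableEq M] (g : Mˣ) (d : ℕ) :
    (powMatrix (g : M) d).det = (powMatrix g d).det *
      ((powMatrix (g : M) d).toSquareBlockProp fun x => ¬ IsUnit x).det := by
  rw [Matrix.twoBlockTriangular_det _ fun x => IsUnit x]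
  · congr 1
    let f : Mˣ → {x : M // IsUnit x} := fun v => ⟨v, v.isUnit⟩
    have hf : Function.Bijective f :=
      ⟨fun v w h => Units.ext (congrArg Subtype.val h), fun x => ⟨x.2.unit, Subtype.ext rfl⟩⟩
    rw [← Matrix.det_submatrix_equiv_self (Equiv.ofBijective f hf)]
    congr 1
    ext x y
    simp only [Matrix.submatrix_apply, Matrix.toSquareBlockProp_def, Matrix.of_apply,
      powMatrix_apply, Equiv.ofBijective_apply, f]
    simp [Units.ext_iff]
  · intro x hx y hy
    rw [powMatrix_apply, if_neg]
    rintro ⟨k, -, rfl⟩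
    exact hx (by simpa [← Units.val_pow_eq_pow_val] using hy)

theorem ZMod.prime_mul_intCast_eq_iff {p : ℕ} (hp : p.Prime) (n : ℕ) (a b : ℤ) :
    ((p * a : ℤ) : ZMod (p ^ (n + 1))) = ((p * b : ℤ) : ZMod (p ^ (n + 1))) ↔
      (a : ZMod (p ^ n)) = b := by
  have hp0 : (p : ℤ) ≠ 0 := by exact_mod_cast hp.ne_zero
  rw [ZMod.intCast_eq_intCast_iff_dvd_sub, ZMod.intCast_eq_intCast_iff_dvd_sub, ← mul_sub]
  push_cast
  rw [pow_succ', mul_dvd_mul_iff_left hp0]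

theorem ZMod.isUnit_intCast_prime_pow_iff {p : ℕ} (hp : p.Prime) (n : ℕ) (a : ℤ) :
    IsUnit (a : ZMod (p ^ (n + 1))) ↔ ¬ (p : ℤ) ∣ a := by
  rw [ZMod.coe_int_isUnit_iff_isCoprime]
  push_cast
  rw [IsCoprime.pow_left_iff n.succ_pos, Prime.coprime_iff_not_dvd (Nat.prime_iff_prime_int.1 hp)]

open scoped Classical in
theorem det_powMatrix_not_isUnit {p : ℕ} [Fact p.Prime] (n d : ℕ) (c : ℤ) :
    ((powMatrix (c : ZMod (p ^ (n + 1))) d).toSquareBlockProp fun x => ¬ IsUnit x).det =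
      (powMatrix (c : ZMod (p ^ n)) d).det := by
  have hp : p.Prime := Fact.out
  let f : ZMod (p ^ n) → {x : ZMod (p ^ (n + 1)) // ¬ IsUnit x} := fun x =>
    ⟨((p * (x.val : ℤ) : ℤ) : ZMod (p ^ (n + 1))), by
      rw [ZMod.isUnit_intCast_prime_pow_iff hp, not_not]
      exact dvd_mul_right _ _⟩
  have hval (x : ZMod (p ^ n)) : ((x.val : ℤ) : ZMod (p ^ n)) = x := by simp
  have hf : Function.Bijective f := by
    constructor
    · intro x y hxy
      have h := (ZMod.prime_mul_intCast_eq_iff hp n _ _).1 (congrArg Subtype.val hxy)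
      rwa [hval, hval] at h
    · rintro ⟨y, hy⟩
      obtain ⟨b, rfl⟩ := ZMod.intCast_surjective y
      rw [ZMod.isUnit_intCast_prime_pow_iff hp, not_not] at hy
      obtain ⟨a, rfl⟩ := hy
      refine ⟨a, Subtype.ext ?_⟩
      rw [ZMod.prime_mul_intCast_eq_iff hp, hval]
  rw [← Matrix.det_submatrix_equiv_self (Equiv.ofBijective f hf)]
  congr 1
  ext x y
  simp only [Matrix.submatrix_apply, Matrix.toSquareBlockProp_def, Matrix.of_apply,
    powMatrix_apply, Equiv.ofBijective_apply, f]
  refine if_congr (exists_congr fun k => and_congr_right fun _ => ?_) rfl rfl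
  rw [← Int.cast_pow, ← Int.cast_mul, mul_assoc, ZMod.prime_mul_intCast_eq_iff hp, hval,
    Int.cast_mul, hval, Int.cast_pow]

theorem det_powMatrix_units_zmod {p : ℕ} [Fact p.Prime] (hp2 : p ≠ 2) (n d : ℕ) (u : ℤ)
    (hu : ¬ (p : ℤ) ∣ u) (hd : 1 ≤ d) (hdp : d < p) (g : (ZMod (p ^ (n + 2)))ˣ)
    (hg : (g : ZMod (p ^ (n + 2))) = 1 + p * u) :
    (powMatrix g d).det = (d : ℤ) ^ (p - 1) := by
  have hp : p.Prime := Fact.out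
  have horder : orderOf g = p ^ (n + 1) := by
    rw [← orderOf_units, hg]
    exact ZMod.orderOf_one_add_mul_prime hp hp2 u hu (n + 1)
  have hle : d ≤ orderOf g := by
    rw [horder]
    exact hdp.le.trans (Nat.le_self_pow n.succ_ne_zero p)
  have hcop : (orderOf g).Coprime d := by
    rw [horder]
    exact Nat.Coprime.pow_left _ (Nat.coprime_of_lt_prime (by omega) hdp hp)
  have hindex : (Subgroup.zpowers g).index = p - 1 := by
    have h := (Subgroup.zpowers g).index_mul_card
    rw [Nat.card_zpowers, horder, Nat.card_eq_fintype_card, ZMod.card_units_eq_totient,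
      Nat.totient_prime_pow_succ hp, mul_comm] at h
    exact Nat.eq_of_mul_eq_mul_left (pow_pos hp.pos _) h
  rw [det_powMatrix_group g d hle hcop, hindex]

theorem det_powMatrix_zmod_prime {p : ℕ} [Fact p.Prime] (d : ℕ) (u : ℤ) (hd : 1 ≤ d) :
    (powMatrix ((1 + p * u : ℤ) : ZMod (p ^ (0 + 1))) d).det = 1 := by
  have h : ((p : ℤ) : ZMod (p ^ (0 + 1))) = 0 := by
    rw [ZMod.intCast_zmod_eq_zero_iff_dvd]
    simp
  rw [powMatrix_eq_one _ hd, Matrix.det_one]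
  intro k _
  rw [Int.cast_add, Int.cast_mul, h]
  simp

theorem det_powMatrix_zmod_of_lt {p : ℕ} [Fact p.Prime] (n d : ℕ) (u : ℤ)
    (hu : ¬ (p : ℤ) ∣ u) (hd : 1 ≤ d) (hdp : d < p) :
    (powMatrix ((1 + p * u : ℤ) : ZMod (p ^ (n + 1))) d).det = (d : ℤ) ^ ((p - 1) * n) := by
  classical
  induction n with
  | zero =>
    rw [det_powMatrix_zmod_prime d u hd, mul_zero, pow_zero]
  | succ n ih =>
    by_cases hp2 : p = 2
    · obtain rfl : d = 1 := by omega
      rw [powMatrix_eq_one _ le_rfl (by simp), Matrix.det_one]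
      simp
    have hp : p.Prime := Fact.out
    have hunit : IsUnit ((1 + p * u : ℤ) : ZMod (p ^ (n + 2))) := by
      rw [ZMod.isUnit_intCast_prime_pow_iff hp, dvd_add_left (dvd_mul_right _ _)]
      exact (Nat.prime_iff_prime_int.1 hp).not_dvd_one
    have h := det_powMatrix_units hunit.unit d
    rw [IsUnit.unit_spec, det_powMatrix_not_isUnit, ih,
      det_powMatrix_units_zmod hp2 n d u hu hd hdp _ (by simp)] at h
    rw [h, ← pow_add, mul_add, mul_one, add_comm]

theorem det_powMatrix_eq_zero {M : Type*} [CommMonoid M] [Fintype M] [DecidableEq M] {g r : M}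
    {m d : ℕ} (hm : 0 < m) (hmd : m ≤ d) (hne : r ≠ r * g) (hperiod : r * g ^ m = r) :
    (powMatrix g d).det = 0 := by
  have hmod (k : ℕ) : r * g ^ k = r * g ^ (k % m) := by
    have h (q : ℕ) : r * g ^ (m * q) = r := by
      induction q with
      | zero => simp
      | succ q ih => rw [mul_add, mul_one, pow_add, ← mul_assoc, ih, hperiod]
    conv_lhs => rw [← Nat.div_add_mod k m, pow_add, ← mul_assoc, h]
  have hlt (k : ℕ) : k % m < d := (Nat.mod_lt k hm).trans_le hmd
  refine Matrix.det_zero_of_row_eq hne ?_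
  classical
  ext y
  rw [powMatrix_apply, powMatrix_apply]
  refine if_congr ⟨?_, ?_⟩ rfl rfl
  · rintro ⟨k, -, rfl⟩
    refine ⟨(k + (m - 1)) % m, hlt _, ?_⟩
    rw [mul_right_comm, ← hmod, mul_assoc, ← pow_succ, add_assoc, Nat.sub_add_cancel hm,
      pow_add, mul_comm (g ^ k), ← mul_assoc, hperiod]
  · rintro ⟨k, -, rfl⟩
    refine ⟨(k + 1) % m, hlt _, ?_⟩
    rw [← hmod, pow_succ', mul_assoc]

theorem det_powMatrix_zmod_of_le {p : ℕ} [Fact p.Prime] (n d : ℕ) (u : ℤ)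
    (hu : ¬ (p : ℤ) ∣ u) (hdp : p ≤ d) :
    (powMatrix ((1 + p * u : ℤ) : ZMod (p ^ (n + 2))) d).det = 0 := by
  have hp : p.Prime := Fact.out
  set g : ZMod (p ^ (n + 2)) := ((1 + p * u : ℤ) : ZMod (p ^ (n + 2))) with hg
  let r : ZMod (p ^ (n + 2)) := ((p ^ n : ℤ) : ZMod (p ^ (n + 2)))
  have hp0 : (p : ℤ) ≠ 0 := by exact_mod_cast hp.ne_zero
  have hne : r ≠ r * g := by
    intro h
    simp only [r, hg, ← Int.cast_mul] at h
    rw [ZMod.intCast_eq_intCast_iff_dvd_sub] at h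
    push_cast at h
    rw [show (p : ℤ) ^ n * (1 + p * u) - p ^ n = p ^ (n + 1) * u by ring, pow_succ _ (n + 1),
      mul_dvd_mul_iff_left (pow_ne_zero _ hp0)] at h
    exact hu h
  have hperiod : r * g ^ p = r := by
    have hdvd : (p : ℤ) ^ 2 ∣ (1 + p * u) ^ p - 1 ^ p := by
      have := dvd_sub_pow_of_dvd_sub (R := ℤ) (p := p) (a := 1 + p * u) (b := 1)
        (by simp) 1
      simpa using this
    obtain ⟨t, ht⟩ := hdvd
    simp only [r, hg, ← Int.cast_mul, ← Int.cast_pow]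
    rw [eq_comm, ZMod.intCast_eq_intCast_iff_dvd_sub]
    push_cast
    refine ⟨t, ?_⟩
    rw [one_pow] at ht
    linear_combination (p : ℤ) ^ n * ht
  exact det_powMatrix_eq_zero hp.pos hdp hne hperiod

open scoped Classical in
/-- Theorem 5.5 (Theorem `03122`): the determinant of the matrix `A(p,n,d,u)`. -/
theorem det_A_matrix (p n d : ℕ) (u : ℤ) (hp : p.Prime) (hn : 1 ≤ n) (hd : 1 ≤ d)
    (hu : Int.gcd (p : ℤ) u = 1) :
    (Matrix.of fun i j : Fin (p ^ n) =>
        if ∃ k < d,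
            ((j : ℕ) : ℤ) + 1 ≡ (((i : ℕ) : ℤ) + 1 - 1) * (1 + (p : ℤ) * u) ^ k + 1
              [ZMOD ((p : ℤ) ^ n)]
          then (1 : ℤ) else 0).det =
      if n = 1 then 1 else if d < p then (d : ℤ) ^ ((p - 1) * (n - 1)) else 0 := by
  have : Fact p.Prime := ⟨hp⟩
  have hpu : ¬ (p : ℤ) ∣ u := by
    rw [← Prime.coprime_iff_not_dvd (Nat.prime_iff_prime_int.1 hp)]
    exact Int.isCoprime_iff_gcd_eq_one.2 hu
  let f : Fin (p ^ n) → ZMod (p ^ n) := fun i => ((i : ℕ) : ZMod (p ^ n))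
  have hf : Function.Bijective f := by
    rw [Fintype.bijective_iff_injective_and_card]
    refine ⟨fun i j h => Fin.ext ?_, by simp [ZMod.card]⟩
    have h' := (ZMod.natCast_eq_natCast_iff' _ _ _).1 h
    rwa [Nat.mod_eq_of_lt i.2, Nat.mod_eq_of_lt j.2] at h'
  have hdet : (Matrix.of fun i j : Fin (p ^ n) =>
        if ∃ k < d,
            ((j : ℕ) : ℤ) + 1 ≡ (((i : ℕ) : ℤ) + 1 - 1) * (1 + (p : ℤ) * u) ^ k + 1
              [ZMOD ((p : ℤ) ^ n)]
          then (1 : ℤ) else 0).det =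
      (powMatrix ((1 + p * u : ℤ) : ZMod (p ^ n)) d).det := by
    rw [← Matrix.det_submatrix_equiv_self (Equiv.ofBijective f hf)]
    congr 1
    ext i j
    rw [Matrix.of_apply, Matrix.submatrix_apply, powMatrix_apply]
    refine if_congr (exists_congr fun k => and_congr_right fun _ => ?_) rfl rfl
    rw [← Nat.cast_pow, ← ZMod.intCast_eq_intCast_iff]
    simp [f]
  rw [hdet]
  obtain ⟨m, rfl⟩ : ∃ m, n = m + 1 := ⟨n - 1, by omega⟩
  cases m with
  | zero =>
    rw [if_pos rfl, det_powMatrix_zmod_prime d u hd]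
  | succ m =>
    rw [if_neg (by omega)]
    split_ifs with hdp
    · exact det_powMatrix_zmod_of_lt (m + 1) d u hpu hd hdp
    · exact det_powMatrix_zmod_of_le m d u hpu (not_lt.1 hdp)
end

section
/- The equivalence classes of the relation ∼ on {1, …, p^n} are exactly the singleton {1} together with the sets T_{i,m} := { j ∈ {1, …, p^n} : j ≡ i·p^{m-1} + 1 + p^m·l (mod p^n) for some integer l } for 1 ≤ i ≤ p−1 and 1 ≤ m ≤ n. In particular, any two elements of the same set T_{i,m} are ∼-equivalent, and no element of T_{i,m} is ∼-equivalent to an element of T_{i',m'} with (i,m) ≠ (i',m') or to 1. -/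
open scoped Classical in
/-- The `(i,j)` entry of the matrix `A(p,n,d,u)`, for `i, j ∈ {1, …, p^n}`:
it is `1` iff `j ≡ (i-1)(1+pu)^k + 1 (mod p^n)` for some `0 ≤ k ≤ d-1`. -/
noncomputable def entryA (p n d : ℕ) (u : ℤ) (i j : ℕ) : ℤ :=
  if ∃ k < d, (j : ℤ) ≡ ((i : ℤ) - 1) * (1 + (p : ℤ) * u) ^ k + 1 [ZMOD ((p : ℤ) ^ n)]
    then 1 else 0

/-- The relation `≈` on `{1, …, p^n}`: `s ≈ t` iff some row `r` has `a_{rs} = 1 = a_{rt}`. -/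
def approxRel (p n d : ℕ) (u : ℤ) (s t : ℕ) : Prop :=
  ∃ r, 1 ≤ r ∧ r ≤ p ^ n ∧ entryA p n d u r s = 1 ∧ entryA p n d u r t = 1

/-- The set `T_{i,m} = { j ∈ {1,…,p^n} : j ≡ i·p^{m-1} + 1 + p^m·l (mod p^n) for some l ∈ ℤ }`. -/
def Tclass (p n i m : ℕ) : Set ℕ :=
  {j | 1 ≤ j ∧ j ≤ p ^ n ∧
    ∃ l : ℤ, (j : ℤ) ≡ (i : ℤ) * (p : ℤ) ^ (m - 1) + 1 + (p : ℤ) ^ m * l [ZMOD ((p : ℤ) ^ n)]}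

lemma exists_one_add_pow_eq (z : ℤ) (j : ℕ) : ∃ e : ℤ, (1 + z) ^ j = 1 + j * z + z ^ 2 * e := by
  induction j with
  | zero => exact ⟨0, by simp⟩
  | succ j ih =>
    obtain ⟨e, he⟩ := ih
    exact ⟨j + e + z * e, by rw [pow_succ, he]; push_cast; ring⟩

/-- Modulo a power of an odd prime `p`, the powers of `1 + p * u` with `p ∤ u` cover the residues
congruent to `1` modulo `p`. -/
lemma exists_pow_modEq_of_modEq_one {p : ℕ} (hp : p.Prime) (hodd : Odd p) {u : ℤ}
    (hu : IsCoprime (p : ℤ) u) {y : ℤ} (hy : (p : ℤ) ∣ y - 1) (n : ℕ) :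
    ∃ k : ℕ, (p : ℤ) ^ n ∣ y - (1 + p * u) ^ k := by
  rcases n with _ | N
  · exact ⟨0, by simp⟩
  induction N with
  | zero => exact ⟨0, by simpa using hy⟩
  | succ N ih =>
    obtain ⟨k, c, hc⟩ := ih
    have hp3 : 3 ≤ p := by
      have := hp.two_le
      obtain ⟨a, ha⟩ := hodd
      omega
    obtain ⟨y', hy'⟩ := ZMod.exists_one_add_mul_pow_prime_pow_eq (R := ℤ) (u := p) (v := p) hp
      dvd_rfl ((show (p : ℤ) * p * p = p ^ 3 by ring) ▸ pow_dvd_pow (p : ℤ) hp3) u N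
    have hw : IsCoprime (p : ℤ) (u + p * y') := by
      simpa using hu
    obtain ⟨a, b, hab⟩ := hw
    have hp0 : (0 : ℤ) < p := by exact_mod_cast hp.pos
    obtain ⟨j, hj⟩ := Int.eq_ofNat_of_zero_le (Int.emod_nonneg (b * c) hp0.ne')
    have hj' := Int.emod_add_mul_ediv (b * c) p
    rw [hj] at hj'
    obtain ⟨e, he⟩ := exists_one_add_pow_eq ((p : ℤ) ^ N * p * (u + p * y')) j
    obtain ⟨f, hf⟩ : (p : ℤ) ∣ (1 + p * u) ^ k - 1 := by
      have := sub_dvd_pow_sub_pow (1 + (p : ℤ) * u) 1 k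
      simp only [add_sub_cancel_left, one_pow] at this
      exact (dvd_mul_right _ _).trans this
    refine ⟨k + p ^ N * j, a * c + (u + p * y') * (b * c / p) - j * (u + p * y') * f
      - (1 + p * u) ^ k * p ^ N * (u + p * y') ^ 2 * e, ?_⟩
    rw [pow_add (1 + (p : ℤ) * u), pow_mul, hy', he, eq_add_of_sub_eq hc]
    generalize b * c / (p : ℤ) = g at *
    generalize (1 + (p : ℤ) * u) ^ k = Q at *
    obtain rfl : Q = 1 + p * f := by linear_combination hf
    linear_combination (-(p : ℤ) ^ (N + 1) * c) * hab - (p : ℤ) ^ (N + 1) * (u + p * y') * hj'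

lemma entryA_eq_one_iff {p n d : ℕ} {u : ℤ} {i j : ℕ} :
    entryA p n d u i j = 1 ↔
      ∃ k < d, (p : ℤ) ^ n ∣ ((i : ℤ) - 1) * (1 + p * u) ^ k - (j - 1) := by
  have (k : ℕ) : (j : ℤ) ≡ ((i : ℤ) - 1) * (1 + (p : ℤ) * u) ^ k + 1 [ZMOD ((p : ℤ) ^ n)] ↔
      (p : ℤ) ^ n ∣ ((i : ℤ) - 1) * (1 + p * u) ^ k - (j - 1) := by
    rw [Int.modEq_iff_dvd]
    ring_nf
  simp only [entryA, this]
  split_ifs with h <;> simp [h]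

lemma exists_mem_range_dvd_sub {M : ℕ} (hM : 0 < M) (x : ℤ) :
    ∃ r : ℕ, 1 ≤ r ∧ r ≤ M ∧ (M : ℤ) ∣ x - (r - 1) := by
  have hM' : (0 : ℤ) < M := by exact_mod_cast hM
  obtain ⟨j, hj⟩ := Int.eq_ofNat_of_zero_le (Int.emod_nonneg x hM'.ne')
  have hlt := Int.emod_lt_of_pos x hM'
  refine ⟨j + 1, by omega, by omega, x / M, ?_⟩
  have := Int.emod_add_mul_ediv x M
  push_cast
  linear_combination hj - this

lemma eqvGen_approxRel_of_dvd {p n d : ℕ} {u : ℤ} (hp : 0 < p) (hd : 2 ≤ d) {s : ℕ} (hs : 1 ≤ s)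
    (hs' : s ≤ p ^ n) (k : ℕ) :
    ∀ t : ℕ, (p : ℤ) ^ n ∣ ((s : ℤ) - 1) * (1 + p * u) ^ k - (t - 1) →
      Relation.EqvGen (approxRel p n d u) s t := by
  induction k with
  | zero =>
    intro t ht
    exact .rel _ _ ⟨s, hs, hs', entryA_eq_one_iff.2 ⟨0, by omega, by simp⟩,
      entryA_eq_one_iff.2 ⟨0, by omega, ht⟩⟩
  | succ k ih =>
    intro t ht
    obtain ⟨r, hr, hr', h⟩ :=
      exists_mem_range_dvd_sub (pow_pos hp n) (((s : ℤ) - 1) * (1 + p * u) ^ k)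
    push_cast at h
    refine (ih r h).trans _ _ _ (.rel _ _ ⟨r, hr, hr', entryA_eq_one_iff.2 ⟨0, by omega, by simp⟩,
      entryA_eq_one_iff.2 ⟨1, by omega, ?_⟩⟩)
    convert! dvd_sub ht (h.mul_right (1 + p * u)) using 1
    ring

/-- Multiplication by a number congruent to `1` modulo `p` does not change the leading `p`-adic
digit. -/
lemma dvd_sub_iff_of_dvd_mul_pow_sub {p n m : ℕ} {u x y a : ℤ} (hm : m + 1 ≤ n) {k : ℕ}
    (h : (p : ℤ) ^ n ∣ x * (1 + p * u) ^ k - y) :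
    (p : ℤ) ^ (m + 1) ∣ x - a * p ^ m ↔ (p : ℤ) ^ (m + 1) ∣ y - a * p ^ m := by
  obtain ⟨f, hf⟩ : (p : ℤ) ∣ (1 + p * u) ^ k - 1 := by
    have := sub_dvd_pow_sub_pow (1 + (p : ℤ) * u) 1 k
    simp only [add_sub_cancel_left, one_pow] at this
    exact (dvd_mul_right _ _).trans this
  obtain ⟨c, hc⟩ := (pow_dvd_pow (p : ℤ) hm).trans h
  have hcop : IsCoprime ((p : ℤ) ^ m) ((1 + p * u) ^ k) :=
    .pow ⟨-u, 1, by ring⟩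
  have key : (p : ℤ) ^ m ∣ x → (p : ℤ) ^ (m + 1) ∣ x - y := by
    rintro ⟨x', rfl⟩
    exact ⟨c - x' * f, by linear_combination hc - (p : ℤ) ^ m * x' * hf⟩
  constructor
  · rintro ⟨z, hz⟩
    have := key ⟨a + p * z, by linear_combination hz⟩
    convert! dvd_sub ⟨z, hz⟩ this using 1
    ring
  · rintro ⟨z, hz⟩
    have := key (hcop.dvd_of_dvd_mul_right ⟨a + p * z + p * c, by linear_combination hz + hc⟩)
    convert! dvd_add this ⟨z, hz⟩ using 1
    ring

lemma eqvGen_approxRel_dvd_iff {p n d m : ℕ} {u a : ℤ} (hm : m + 1 ≤ n) {s t : ℕ}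
    (h : Relation.EqvGen (approxRel p n d u) s t) :
    (p : ℤ) ^ (m + 1) ∣ ((s : ℤ) - 1) - a * p ^ m ↔
      (p : ℤ) ^ (m + 1) ∣ ((t : ℤ) - 1) - a * p ^ m := by
  induction h with
  | rel s t h =>
    obtain ⟨r, -, -, hs, ht⟩ := h
    obtain ⟨k, -, hk⟩ := entryA_eq_one_iff.1 hs
    obtain ⟨l, -, hl⟩ := entryA_eq_one_iff.1 ht
    exact (dvd_sub_iff_of_dvd_mul_pow_sub hm hk).symm.trans (dvd_sub_iff_of_dvd_mul_pow_sub hm hl)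
  | refl => rfl
  | symm _ _ _ ih => exact ih.symm
  | trans _ _ _ _ _ ih₁ ih₂ => exact ih₁.trans ih₂

lemma mem_Tclass_iff {p n i m j : ℕ} (hm : m + 1 ≤ n) :
    j ∈ Tclass p n i (m + 1) ↔
      1 ≤ j ∧ j ≤ p ^ n ∧ (p : ℤ) ^ (m + 1) ∣ ((j : ℤ) - 1) - i * p ^ m := by
  simp only [Tclass, Set.mem_ofPred_eq, Int.modEq_iff_dvd, Nat.add_sub_cancel]
  refine and_congr_right fun _ => and_congr_right fun _ => ⟨?_, ?_⟩
  · rintro ⟨l, hl⟩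
    obtain ⟨c, hc⟩ := (pow_dvd_pow (p : ℤ) hm).trans hl
    exact ⟨l - c, by linear_combination -hc⟩
  · rintro ⟨l, hl⟩
    exact ⟨l, 0, by linear_combination -hl⟩

lemma isCoprime_natCast_of_lt {p i : ℕ} (hp : p.Prime) (hi : 1 ≤ i) (hi' : i ≤ p - 1) :
    IsCoprime (p : ℤ) i :=
  Nat.isCoprime_iff_coprime.2 <|
    Nat.coprime_of_lt_prime (by omega) (by have := hp.pos; omega) hp

lemma eqvGen_of_mem_Tclass {p n d : ℕ} {u : ℤ} (hp : p.Prime) (hodd : Odd p) (hd : 2 ≤ d)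
    (hu : IsCoprime (p : ℤ) u) {i m s t : ℕ} (hi : IsCoprime (p : ℤ) i) (hm : m + 1 ≤ n)
    (hs : s ∈ Tclass p n i (m + 1)) (ht : t ∈ Tclass p n i (m + 1)) :
    Relation.EqvGen (approxRel p n d u) s t := by
  rw [mem_Tclass_iff hm] at hs ht
  obtain ⟨hs₁, hs₂, a, ha⟩ := hs
  obtain ⟨ht₁, ht₂, b, hb⟩ := ht
  have hcop : IsCoprime ((p : ℤ) ^ (n + 1)) (i + p * a) :=
    .pow_left (by simpa using hi)
  obtain ⟨v, w, hvw⟩ := hcop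
  rw [pow_succ] at hvw
  -- `w` inverts `i + p * a`, so `w * (i + p * b)` is the required ratio
  have hy : (p : ℤ) ∣ w * (i + p * b) - 1 :=
    ⟨w * (b - a) - v * p ^ n, by linear_combination hvw⟩
  obtain ⟨k, c, hc⟩ := exists_pow_modEq_of_modEq_one hp hodd hu hy n
  refine eqvGen_approxRel_of_dvd hp.pos hd hs₁ hs₂ k t
    ⟨-p ^ m * (i + p * a) * c - p ^ m * p * v * (i + p * b), ?_⟩
  generalize (1 + (p : ℤ) * u) ^ k = Q at *
  linear_combination Q * ha - hb - (p : ℤ) ^ m * (i + p * a) * hc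
    + (p : ℤ) ^ m * (i + p * b) * hvw

lemma not_dvd_mul_pow {p i m : ℕ} (hp : p.Prime) (hi : IsCoprime (p : ℤ) i) :
    ¬ (p : ℤ) ^ (m + 1) ∣ i * p ^ m := by
  rw [pow_succ', mul_dvd_mul_iff_right (pow_ne_zero _ (by exact_mod_cast hp.ne_zero))]
  intro h
  exact (Nat.prime_iff_prime_int.1 hp).not_isUnit (hi.isUnit_of_dvd' dvd_rfl h)

lemma le_of_dvd_sub_of_dvd_sub {p i m i' m' : ℕ} {x : ℤ} (hp : p.Prime)
    (hi : IsCoprime (p : ℤ) i) (h : (p : ℤ) ^ (m + 1) ∣ x - i * p ^ m)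
    (h' : (p : ℤ) ^ (m' + 1) ∣ x - i' * p ^ m') : m' ≤ m := by
  by_contra! hlt
  have hx : (p : ℤ) ^ m' ∣ x :=
    (dvd_sub_left (dvd_mul_left _ _)).1 ((pow_dvd_pow _ m'.le_succ).trans h')
  exact not_dvd_mul_pow hp hi ((dvd_sub_right ((pow_dvd_pow _ hlt).trans hx)).1 h)

lemma eq_and_eq_of_dvd_sub_of_dvd_sub {p i m i' m' : ℕ} {x : ℤ} (hp : p.Prime)
    (hi : 1 ≤ i) (hip : i ≤ p - 1) (hi' : 1 ≤ i') (hip' : i' ≤ p - 1)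
    (h : (p : ℤ) ^ (m + 1) ∣ x - i * p ^ m) (h' : (p : ℤ) ^ (m' + 1) ∣ x - i' * p ^ m') :
    i = i' ∧ m = m' := by
  obtain rfl : m = m' := le_antisymm
    (le_of_dvd_sub_of_dvd_sub hp (isCoprime_natCast_of_lt hp hi' hip') h' h)
    (le_of_dvd_sub_of_dvd_sub hp (isCoprime_natCast_of_lt hp hi hip) h h')
  refine ⟨?_, rfl⟩
  have := dvd_sub h h'
  rw [sub_sub_sub_cancel_left, ← sub_mul, pow_succ',
    mul_dvd_mul_iff_right (pow_ne_zero _ (by exact_mod_cast hp.ne_zero)),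
    ← Nat.modEq_iff_dvd] at this
  exact this.eq_of_lt_of_lt (by omega) (by omega)

lemma exists_mem_Tclass {p n j : ℕ} (hp : p.Prime) (hj : 1 < j) (hj' : j ≤ p ^ n) :
    ∃ i m, 1 ≤ i ∧ i ≤ p - 1 ∧ 1 ≤ m ∧ m ≤ n ∧ j ∈ Tclass p n i m := by
  obtain ⟨m, b, hb, hmb⟩ :=
    Nat.exists_eq_pow_mul_and_not_dvd (n := j - 1) (by omega) p hp.ne_one
  have hm : m + 1 ≤ n := by
    rw [Nat.succ_le_iff, ← Nat.pow_lt_pow_iff_right hp.one_lt]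
    have := Nat.le_of_dvd (by omega) ⟨b, hmb⟩
    omega
  have hlt := Nat.mod_lt b hp.pos
  have hpos : b % p ≠ 0 := fun h => hb (Nat.dvd_of_mod_eq_zero h)
  refine ⟨b % p, m + 1, by omega, by omega, by omega, hm,
    (mem_Tclass_iff hm).2 ⟨hj.le, hj', (b / p : ℕ), ?_⟩⟩
  have hj1 : (j : ℤ) - 1 = p ^ m * b := by
    rw [← Nat.cast_one, ← Nat.cast_sub hj.le, hmb]
    push_cast
    rfl
  have hdiv : ((b % p : ℕ) : ℤ) + p * (b / p : ℕ) = b := by exact_mod_cast Nat.mod_add_div b p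
  linear_combination hj1 - (p : ℤ) ^ m * hdiv

/-- Lemma 5.2 (Lemma `0311`): the equivalence classes of the equivalence relation `∼`
generated by `≈` on `{1, …, p^n}` are exactly the singleton `{1}` together with the sets
`T_{i,m}` for `1 ≤ i ≤ p-1` and `1 ≤ m ≤ n`. -/
theorem eqvGen_classes_of_A (p n d : ℕ) (u : ℤ) (hp : p.Prime) (hodd : Odd p)
    (hn : 1 ≤ n) (hd : 2 ≤ d) (hu : Int.gcd (p : ℤ) u = 1) :
    -- any two elements of the same `T_{i,m}` are `∼`-equivalent
    (∀ i m, 1 ≤ i → i ≤ p - 1 → 1 ≤ m → m ≤ n →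
        ∀ s ∈ Tclass p n i m, ∀ t ∈ Tclass p n i m, Relation.EqvGen (approxRel p n d u) s t) ∧
    -- elements of different `T_{i,m}`'s are not `∼`-equivalent
    (∀ i m i' m', 1 ≤ i → i ≤ p - 1 → 1 ≤ m → m ≤ n →
        1 ≤ i' → i' ≤ p - 1 → 1 ≤ m' → m' ≤ n → (i, m) ≠ (i', m') →
        ∀ s ∈ Tclass p n i m, ∀ t ∈ Tclass p n i' m', ¬ Relation.EqvGen (approxRel p n d u) s t) ∧
    -- no element of a `T_{i,m}` is `∼`-equivalent to `1`
    (∀ i m, 1 ≤ i → i ≤ p - 1 → 1 ≤ m → m ≤ n →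
        ∀ s ∈ Tclass p n i m, ¬ Relation.EqvGen (approxRel p n d u) s 1) ∧
    -- the singleton `{1}` and the `T_{i,m}` exhaust `{1, …, p^n}`
    (∀ j, 1 ≤ j → j ≤ p ^ n →
        j = 1 ∨ ∃ i m, 1 ≤ i ∧ i ≤ p - 1 ∧ 1 ≤ m ∧ m ≤ n ∧ j ∈ Tclass p n i m) := by
  have hu' : IsCoprime (p : ℤ) u := Int.isCoprime_iff_gcd_eq_one.2 hu
  refine ⟨?_, ?_, ?_, ?_⟩
  · rintro i (_ | m) hi hip hm hmn s hs t ht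
    · omega
    exact eqvGen_of_mem_Tclass hp hodd hd hu' (isCoprime_natCast_of_lt hp hi hip) hmn hs ht
  · rintro i (_ | m) i' (_ | m') hi hip hm hmn hi' hip' hm' hmn' hne s hs t ht h
    any_goals omega
    rw [mem_Tclass_iff hmn] at hs
    rw [mem_Tclass_iff hmn'] at ht
    obtain ⟨rfl, rfl⟩ := eq_and_eq_of_dvd_sub_of_dvd_sub hp hi hip hi' hip'
      ((eqvGen_approxRel_dvd_iff hmn h).1 hs.2.2) ht.2.2
    exact hne rfl
  · rintro i (_ | m) hi hip hm hmn s hs h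
    · omega
    rw [mem_Tclass_iff hmn] at hs
    refine not_dvd_mul_pow hp (isCoprime_natCast_of_lt hp hi hip) (m := m) ?_
    simpa using (eqvGen_approxRel_dvd_iff hmn h).1 hs.2.2
  · intro j hj hj'
    rcases hj.eq_or_lt with rfl | hj
    · exact .inl rfl
    · exact .inr (exists_mem_Tclass hp hj hj')
end

section
/- The determinant of the circulant matrix C equals d. -/
open Finset Matrix in
/-- A power sum over `d` cyclically consecutive exponents, starting at `i`. -/
lemma sum_ite_emod_sub_lt_mul_pow {R : Type*} [Semiring R] {n d : ℕ} (hdn : d ≤ n) (w : R)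
    (hw : w ^ n = 1) (i : Fin n) :
    (∑ j : Fin n, if (((j : ℕ) : ℤ) - ((i : ℕ) : ℤ)) % (n : ℤ) < (d : ℤ) then w ^ (j : ℕ) else 0) =
      (∑ l ∈ range d, w ^ l) * w ^ (i : ℕ) := by
  have hn : 0 < n := i.pos
  have hnz : (0 : ℤ) < n := by exact_mod_cast hn
  rw [← sum_filter, sum_mul]
  symm
  refine sum_bij (fun l _ => (⟨(l + i) % n, Nat.mod_lt _ hn⟩ : Fin n)) ?_ ?_ ?_ ?_
  · intro l hl
    have hl' := mem_range.mp hl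
    rw [mem_filter]
    refine ⟨mem_univ _, ?_⟩
    push_cast
    rw [Int.emod_sub_emod, add_sub_cancel_right,
      Int.emod_eq_of_lt (by positivity) (by omega)]
    omega
  · intro a ha b hb h
    rw [mem_range] at ha hb
    have h' : (a + i) ≡ (b + i) [MOD n] := by simpa [Nat.ModEq] using h
    have := Nat.ModEq.add_right_cancel' _ h'
    exact Nat.ModEq.eq_of_lt_of_lt this (by omega) (by omega)
  · intro j hj
    have hj' := (mem_filter.mp hj).2
    have h0 := Int.emod_nonneg ((j : ℕ) - (i : ℕ) : ℤ) hnz.ne'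
    refine ⟨(((j : ℕ) - (i : ℕ) : ℤ) % n).toNat, mem_range.mpr (by omega), ?_⟩
    ext
    zify
    rw [Int.toNat_of_nonneg h0, Int.emod_add_emod, sub_add_cancel,
      Int.emod_eq_of_lt (by positivity) (by exact_mod_cast j.2)]
  · intro l _
    rw [← pow_add]
    exact pow_eq_pow_mod _ hw

open Finset in
/-- The product over all `n`-th roots of unity `x` of `1 + x + ⋯ + x ^ (d - 1)` is `d` when `d` is
coprime to `n`. -/
lemma IsPrimitiveRoot.prod_geom_sum_of_coprime {K : Type*} [Field K] {n d : ℕ} {ζ : K}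
    (hζ : IsPrimitiveRoot ζ n) (hn : 0 < n) (hd : d.Coprime n) :
    ∏ k ∈ range n, ∑ l ∈ range d, (ζ ^ k) ^ l = (d : K) := by
  rw [← mul_prod_erase _ _ (mem_range.mpr hn)]
  have hne : ∏ k ∈ (range n).erase 0, (ζ ^ k - 1) ≠ 0 := by
    refine prod_ne_zero_iff.mpr fun k hk => sub_ne_zero.mpr ?_
    rw [mem_erase, mem_range] at hk
    exact hζ.pow_ne_one_of_pos_of_lt hk.1 hk.2
  have hmaps : Set.MapsTo (fun k => k * d % n) ((range n).erase 0 : Finset ℕ)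
      ((range n).erase 0 : Finset ℕ) := by
    intro k hk
    simp only [mem_coe, mem_erase, mem_range] at hk ⊢
    refine ⟨fun h => ?_, Nat.mod_lt _ hn⟩
    exact hk.1 (Nat.eq_zero_of_dvd_of_lt
      (hd.symm.dvd_of_dvd_mul_right (Nat.dvd_of_mod_eq_zero h)) hk.2)
  have hinj : Set.InjOn (fun k => k * d % n) ((range n).erase 0 : Finset ℕ) := by
    intro a ha b hb h
    simp only [mem_coe, mem_erase, mem_range] at ha hb
    exact (Nat.ModEq.cancel_right_of_coprime hd.symm h).eq_of_lt_of_lt ha.2 hb.2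
  have hprod : ∏ k ∈ (range n).erase 0, ((ζ ^ k) ^ d - 1) =
      ∏ k ∈ (range n).erase 0, (ζ ^ k - 1) := by
    refine prod_nbij (fun k => k * d % n) hmaps hinj
      (surjOn_of_injOn_of_card_le _ hmaps hinj le_rfl) fun k _ => ?_
    rw [← pow_mul, ← pow_eq_pow_mod _ hζ.pow_eq_one]
  have h1 : ∏ k ∈ (range n).erase 0, ∑ l ∈ range d, (ζ ^ k) ^ l = 1 := by
    refine mul_right_cancel₀ hne ?_
    rw [← prod_mul_distrib, one_mul, ← hprod]
    exact prod_congr rfl fun k _ => geom_sum_mul _ _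
  rw [h1]
  simp

open Matrix in
/-- The `n × n` circulant matrix whose rows consist of `d` cyclically consecutive ones has
determinant `d` when `d` is coprime to `n`. -/
lemma det_consecutive_ones_of_coprime {n d : ℕ} (hn : 0 < n) (hdn : d ≤ n) (hd : d.Coprime n) :
    (Matrix.of fun i j : Fin n =>
        if (((j : ℕ) : ℤ) - ((i : ℕ) : ℤ)) % (n : ℤ) < (d : ℤ) then (1 : ℤ) else 0).det =
      (d : ℤ) := by
  set C : Matrix (Fin n) (Fin n) ℤ := Matrix.of fun i j : Fin n =>
    if (((j : ℕ) : ℤ) - ((i : ℕ) : ℤ)) % (n : ℤ) < (d : ℤ) then (1 : ℤ) else 0 with hC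
  obtain ⟨ζ, hζ⟩ : ∃ ζ : ℂ, IsPrimitiveRoot ζ n := ⟨_, Complex.isPrimitiveRoot_exp n hn.ne'⟩
  let V : Matrix (Fin n) (Fin n) ℂ := vandermonde fun k : Fin n => ζ ^ (k : ℕ)
  have hV : V.det ≠ 0 := det_vandermonde_ne_zero_iff.mpr fun a b h =>
    Fin.ext (hζ.pow_inj a.2 b.2 h)
  have hmul : V * (C.map (Int.castRingHom ℂ))ᵀ =
      diagonal (fun k : Fin n => ∑ l ∈ Finset.range d, (ζ ^ (k : ℕ)) ^ l) * V := by
    ext k i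
    rw [diagonal_mul, mul_apply]
    refine Eq.trans ?_ (sum_ite_emod_sub_lt_mul_pow hdn (ζ ^ (k : ℕ)) ?_ i)
    · refine Finset.sum_congr rfl fun j _ => ?_
      simp [V, hC, vandermonde_apply]
    · rw [pow_right_comm, hζ.pow_eq_one, one_pow]
  have hdet := congrArg det hmul
  rw [det_mul, det_mul, det_transpose, det_diagonal, mul_comm,
    Fin.prod_univ_eq_prod_range (fun k => ∑ l ∈ Finset.range d, (ζ ^ k) ^ l) n,
    hζ.prod_geom_sum_of_coprime hn hd] at hdet
  have hcast : ((C.det : ℤ) : ℂ) = d := by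
    rw [← mul_right_cancel₀ hV hdet]
    exact (Int.castRingHom ℂ).map_det C
  exact_mod_cast hcast

/-- The determinant of the `p^r × p^r` circulant matrix each of whose rows consists of
`d` consecutive (cyclic) ones equals `d`, for `1 ≤ d < p`. -/
theorem det_circulant_consecutive_ones (p r d : ℕ) (hp : p.Prime) (hr : 1 ≤ r)
    (hd1 : 1 ≤ d) (hdp : d < p) :
    (Matrix.of fun i j : Fin (p ^ r) =>
        if (((j : ℕ) : ℤ) - ((i : ℕ) : ℤ)) % ((p : ℤ) ^ r) < (d : ℤ)
          then (1 : ℤ) else 0).det = (d : ℤ) := by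
  have hcop : d.Coprime (p ^ r) :=
    Nat.Coprime.pow_right r (Nat.coprime_of_lt_prime (by omega) hdp hp).symm
  have h := det_consecutive_ones_of_coprime (pow_pos hp.pos r)
    (hdp.le.trans (Nat.le_self_pow (by omega) p)) hcop
  rw [Nat.cast_pow] at h
  exact h
end

section
/- Gal(L/K) is abelian if and only if the action of Gal(K_∞/K) on Gal(L/K_∞) by conjugation of lifts is trivial, i.e., if and only if στσ^{-1} = τ for every σ ∈ Gal(L/K) and every τ ∈ Gal(L/K_∞); equivalently, Gal(L/K) is abelian if and only if Gal(L/K_∞) is contained in the center of Gal(L/K). -/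
/-- Restriction of automorphisms to a normal subextension is continuous for the Krull topologies. -/
theorem AlgEquiv.continuous_restrictNormalHom (K E L : Type*) [Field K] [Field E] [Field L]
    [Algebra K E] [Algebra E L] [Algebra K L] [IsScalarTower K E L] [Normal K E] :
    Continuous (AlgEquiv.restrictNormalHom (F := K) (K₁ := L) E) := by
  apply continuous_of_continuousAt_one _ (continuousAt_def.mpr _)
  intro s hs
  rw [map_one, krullTopology_mem_nhds_one_iff] at hs
  obtain ⟨F, _, hF⟩ := hs
  rw [krullTopology_mem_nhds_one_iff]
  refine ⟨F.map (IsScalarTower.toAlgHom K E L),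
    Module.Finite.equiv (F.equivMap (IsScalarTower.toAlgHom K E L)).toLinearEquiv, fun σ hσ ↦ hF ?_⟩
  simp only [SetLike.mem_coe, IntermediateField.mem_fixingSubgroup_iff] at hσ ⊢
  intro x hx
  apply (algebraMap E L).injective
  exact (σ.restrictNormal_commutes E x).trans (hσ _ ⟨x, hx, rfl⟩)

/-- A closed subgroup of a compact group that contains the kernel of a continuous homomorphism
to `ℤ_p` and an element mapping to `1` is the whole group. -/
theorem Subgroup.eq_top_of_isClosed_of_ker_le {p : ℕ} [Fact p.Prime] {G : Type*} [Group G]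
    [TopologicalSpace G] [CompactSpace G] {f : G →* Multiplicative ℤ_[p]} (hf : Continuous f)
    {H : Subgroup G} (hH : IsClosed (H : Set G)) (hker : f.ker ≤ H) {γ : G}
    (hγ : f γ = Multiplicative.ofAdd 1) (hγH : γ ∈ H) : H = ⊤ := by
  have hcont : Continuous fun g ↦ (f g).toAdd := continuous_toAdd.comp hf
  have hclosed : IsClosed ((fun g ↦ (f g).toAdd) '' (H : Set G)) :=
    (hH.isCompact.image hcont).isClosed
  have hrange : Set.range (Nat.cast : ℕ → ℤ_[p]) ⊆ (fun g ↦ (f g).toAdd) '' (H : Set G) := by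
    rintro _ ⟨n, rfl⟩
    exact ⟨γ ^ n, H.pow_mem hγH n, by simp [hγ]⟩
  have huniv := (PadicInt.denseRange_natCast (p := p)).mono hrange |>.closure_eq
  rw [hclosed.closure_eq] at huniv
  refine (Subgroup.eq_top_iff' H).mpr fun g ↦ ?_
  obtain ⟨h, hh, hfh⟩ := huniv.symm ▸ Set.mem_univ (f g).toAdd
  have hmem : g * h⁻¹ ∈ H := hker <| by
    rw [MonoidHom.mem_ker, map_mul, map_inv, mul_inv_eq_one]
    exact (Multiplicative.toAdd.injective hfh).symm
  simpa using H.mul_mem hmem hh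

/-- A compact Hausdorff group whose quotient by a central subgroup is `ℤ_p` is commutative. -/
theorem Subgroup.center_eq_top_of_ker_le_center {p : ℕ} [Fact p.Prime] {G : Type*} [Group G]
    [TopologicalSpace G] [IsTopologicalGroup G] [CompactSpace G] [T2Space G]
    {f : G →* Multiplicative ℤ_[p]} (hf : Continuous f) (hsurj : Function.Surjective f)
    (hker : f.ker ≤ Subgroup.center G) : Subgroup.center G = ⊤ := by
  obtain ⟨γ, hγ⟩ := hsurj (Multiplicative.ofAdd 1)
  have hcentralizer : Subgroup.centralizer {γ} = ⊤ :=
    eq_top_of_isClosed_of_ker_le hf (Set.isClosed_centralizer _)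
      (hker.trans (Subgroup.center_le_centralizer _)) hγ
      (Subgroup.mem_centralizer_singleton_iff.mpr rfl)
  refine eq_top_of_isClosed_of_ker_le hf ?_ hker hγ ?_
  · rw [← Subgroup.centralizer_univ]
    exact Set.isClosed_centralizer _
  · simpa using Subgroup.centralizer_eq_top_iff_subset.mp hcentralizer

/-- Lemma 2.4 (Lemma `0110`): for a Galois extension `L/K` with intermediate field `K_∞`
such that `Gal(K_∞/K)` is topologically isomorphic to `ℤ_p` and `Gal(L/K_∞)` is abelian,
`Gal(L/K)` is abelian if and only if conjugation by any `σ ∈ Gal(L/K)` is trivial on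
`Gal(L/K_∞)` (viewed as the subgroup of `Gal(L/K)` fixing `K_∞` pointwise). -/
theorem gal_abelian_iff_conj_trivial (p : ℕ) [Fact p.Prime]
    (K Kinf L : Type*) [Field K] [Field Kinf] [Field L]
    [Algebra K Kinf] [Algebra Kinf L] [Algebra K L] [IsScalarTower K Kinf L]
    [IsGalois K L] [IsGalois K Kinf]
    (e : (Kinf ≃ₐ[K] Kinf) ≃* Multiplicative ℤ_[p])
    (he : Continuous e) (he_symm : Continuous e.symm)
    (habelian : ∀ σ τ : L ≃ₐ[K] L,
      (∀ x : Kinf, σ (algebraMap Kinf L x) = algebraMap Kinf L x) →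
      (∀ x : Kinf, τ (algebraMap Kinf L x) = algebraMap Kinf L x) → σ * τ = τ * σ) :
    (∀ σ τ : L ≃ₐ[K] L, σ * τ = τ * σ) ↔
      (∀ σ τ : L ≃ₐ[K] L,
        (∀ x : Kinf, τ (algebraMap Kinf L x) = algebraMap Kinf L x) →
        σ * τ * σ⁻¹ = τ) := by
  constructor
  · intro h σ τ _
    rw [h σ τ, mul_inv_cancel_right]
  · intro h σ τ
    have : T2Space (L ≃ₐ[K] L) := krullTopology_t2
    have hcenter : Subgroup.center (L ≃ₐ[K] L) = ⊤ := by
      refine Subgroup.center_eq_top_of_ker_le_center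
        (f := e.toMonoidHom.comp (AlgEquiv.restrictNormalHom Kinf))
        (he.comp (AlgEquiv.continuous_restrictNormalHom K Kinf L))
        (e.surjective.comp (AlgEquiv.restrictNormalHom_surjective L)) fun ν hν ↦ ?_
      have hres : AlgEquiv.restrictNormalHom Kinf ν = 1 := by
        simpa [MonoidHom.mem_ker] using hν
      refine Subgroup.mem_center_iff.mpr fun g ↦ mul_inv_eq_iff_eq_mul.mp (h g ν fun x ↦ ?_)
      rw [← ν.restrictNormal_commutes Kinf x]
      exact congrArg (algebraMap Kinf L) (DFunLike.congr_fun hres x)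
    exact Subgroup.mem_center_iff.mp (hcenter ▸ Subgroup.mem_top τ) σ
end

section
/- The cyclic subgroup of the unit group (ℤ/p^nℤ)^× generated by the class of 1 + pu is exactly the subgroup { x ∈ (ℤ/p^nℤ)^× : x ≡ 1 (mod p) } of units congruent to 1 modulo p. -/
/-- The kernel of the reduction map `(ℤ/p^(n+1)ℤ)ˣ → (ℤ/pℤ)ˣ` has `p ^ n` elements. -/
theorem ZMod.card_ker_unitsMap_prime_pow {p : ℕ} (hp : p.Prime) (n : ℕ) :
    Nat.card (ZMod.unitsMap (dvd_pow_self p n.succ_ne_zero)).ker = p ^ n := by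
  have : NeZero p := ⟨hp.ne_zero⟩
  have hcard := (ZMod.unitsMap (dvd_pow_self p n.succ_ne_zero)).ker.card_mul_index
  rw [Subgroup.index_ker, MonoidHom.range_eq_top.2 (ZMod.unitsMap_surjective _),
    Subgroup.card_top, Nat.card_eq_fintype_card (α := (ZMod p)ˣ),
    Nat.card_eq_fintype_card (α := (ZMod (p ^ (n + 1)))ˣ), ZMod.card_units_eq_totient,
    ZMod.card_units_eq_totient, Nat.totient_prime_pow_succ hp, Nat.totient_prime hp] at hcard
  exact Nat.eq_of_mul_eq_mul_right (Nat.sub_pos_of_lt hp.one_lt) hcard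

/-- For `p` an odd prime, the cyclic subgroup of `(ℤ/p^nℤ)^×` generated by (the unit
given by) the class of `1 + pu`, with `gcd(p,u) = 1`, is exactly the subgroup of units
congruent to `1` modulo `p`. -/
theorem zpowers_one_add_p_mul_eq_units_congruent_one (p n : ℕ) (hp : p.Prime)
    (hodd : Odd p) (hn : 1 ≤ n) (u : ℤ) (hu : Int.gcd (p : ℤ) u = 1)
    (v : (ZMod (p ^ n))ˣ) (hv : (v : ZMod (p ^ n)) = ((1 + (p : ℤ) * u : ℤ) : ZMod (p ^ n))) :
    (Subgroup.zpowers v : Set (ZMod (p ^ n))ˣ) =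
      {x : (ZMod (p ^ n))ˣ |
        ZMod.castHom (dvd_pow_self p (Nat.one_le_iff_ne_zero.mp hn)) (ZMod p)
          (x : ZMod (p ^ n)) = 1} := by
  obtain ⟨n, rfl⟩ := Nat.exists_eq_succ_of_ne_zero (Nat.one_le_iff_ne_zero.mp hn)
  have hp2 : p ≠ 2 := by
    rintro rfl
    exact absurd hodd (by decide)
  have hpu : ¬ (p : ℤ) ∣ u := fun h => hp.ne_one <| by
    rwa [Int.gcd_eq_natAbs_left h, Int.natAbs_natCast] at hu
  have : NeZero (p ^ (n + 1)) := ⟨pow_ne_zero _ hp.ne_zero⟩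
  have hmem (x : (ZMod (p ^ (n + 1)))ˣ) :
      x ∈ (ZMod.unitsMap (dvd_pow_self p n.succ_ne_zero)).ker ↔
        ZMod.castHom (dvd_pow_self p n.succ_ne_zero) (ZMod p) (x : ZMod (p ^ (n + 1))) = 1 := by
    rw [MonoidHom.mem_ker, Units.ext_iff]
    rfl
  have hle : Subgroup.zpowers v ≤ (ZMod.unitsMap (dvd_pow_self p n.succ_ne_zero)).ker := by
    rw [Subgroup.zpowers_le, hmem, hv, map_intCast]
    simp
  have horder : orderOf v = p ^ n := by
    rw [← orderOf_units, hv, ← ZMod.orderOf_one_add_mul_prime hp hp2 u hpu n]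
    push_cast
    rfl
  have heq := Subgroup.eq_of_le_of_card_ge hle <| by
    rw [Nat.card_zpowers, horder, ZMod.card_ker_unitsMap_prime_pow hp]
  rw [heq]
  exact Set.ext hmem
end

section
/- The quotient Λ/(p^mΛ + ω_nΛ) is finite of cardinality p^{m·p^n}. -/
open Polynomial in
/-- The polynomial `(1 + X) ^ p ^ n - 1` over `ℤ_[p]` is monic of degree `p ^ n`. -/
theorem monic_one_add_X_pow_sub_one (p : ℕ) [Fact p.Prime] (n : ℕ) :
    ((1 + X : ℤ_[p][X]) ^ p ^ n - 1).Monic ∧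
      ((1 + X : ℤ_[p][X]) ^ p ^ n - 1).natDegree = p ^ n := by
  have hpos : 0 < p ^ n := pow_pos (Fact.out : p.Prime).pos n
  have hX : (1 + X : ℤ_[p][X]) = X + C 1 := by rw [map_one, add_comm]
  have hmon : ((1 + X : ℤ_[p][X]) ^ p ^ n).Monic := hX ▸ (monic_X_add_C 1).pow _
  have hnat : ((1 + X : ℤ_[p][X]) ^ p ^ n).natDegree = p ^ n := by
    rw [hX, (monic_X_add_C _).natDegree_pow, natDegree_X_add_C, mul_one]
  have hdeg : (1 : ℤ_[p][X]).degree < ((1 + X : ℤ_[p][X]) ^ p ^ n).degree := by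
    rw [degree_eq_natDegree hmon.ne_zero, hnat, degree_one]
    exact_mod_cast hpos
  exact ⟨hmon.sub_of_left hdeg,
    (natDegree_sub_eq_left_of_natDegree_lt (by simp [hnat, hpos])).trans hnat⟩

open Polynomial in
/-- The polynomial `(1 + X) ^ p ^ n - 1` over `ℤ_[p]` is distinguished. -/
theorem isDistinguishedAt_one_add_X_pow_sub_one (p : ℕ) [Fact p.Prime] (n : ℕ) :
    ((1 + X : ℤ_[p][X]) ^ p ^ n - 1).IsDistinguishedAt (IsLocalRing.maximalIdeal ℤ_[p]) where
  monic := (monic_one_add_X_pow_sub_one p n).1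
  mem {i} hi := by
    rw [(monic_one_add_X_pow_sub_one p n).2] at hi
    rcases eq_or_ne i 0 with rfl | hi0
    · simp [coeff_zero_eq_eval_zero]
    · rw [coeff_sub, coeff_one_add_X_pow, coeff_one, if_neg hi0, sub_zero,
        PadicInt.maximalIdeal_eq_span_p, Ideal.mem_span_singleton]
      exact Nat.cast_dvd_cast ((Fact.out : p.Prime).dvd_choose_pow hi0 hi.ne)

open Polynomial in
/-- Division with remainder by a distinguished polynomial `g` identifies the kernel of a linear
surjection from power series onto `A ^ deg g`. -/
theorem Polynomial.IsDistinguishedAt.exists_linearMap {A : Type*} [CommRing A] {I : Ideal A}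
    [IsAdicComplete I A] {g : A[X]} (hg : g.IsDistinguishedAt I) :
    ∃ L : PowerSeries A →ₗ[A] (Fin g.natDegree → A), Function.Surjective L ∧
      ∀ f, L f = 0 ↔ (g : PowerSeries A) ∣ f := by
  let e : (PowerSeries A ⧸ Ideal.span {(g : PowerSeries A)}) ≃ₗ[A] (Fin g.natDegree → A) :=
    hg.algEquivQuotient.symm.toLinearEquiv.trans (AdjoinRoot.powerBasisAux' hg.monic).equivFun
  refine ⟨e.toLinearMap ∘ₗ (Ideal.Quotient.mkₐ A _).toLinearMap,
    e.surjective.comp Ideal.Quotient.mk_surjective, fun f ↦ ?_⟩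
  rw [← Ideal.mem_span_singleton, ← Ideal.Quotient.eq_zero_iff_mem]
  exact e.map_eq_zero_iff

/-- Lemma (used for Lemma 2.2): the quotient `Λ/(p^mΛ + ω_nΛ)`, where `Λ = ℤ_p[[T]]` and
`ω_n = (1+T)^{p^n} - 1`, is finite of cardinality `p^{m·p^n}`. -/
theorem quot_p_pow_omega_card (p : ℕ) [Fact p.Prime] (m n : ℕ) (hm : 1 ≤ m) :
    Finite (PowerSeries ℤ_[p] ⧸
        Ideal.span {(p : PowerSeries ℤ_[p]) ^ m,
          (1 + PowerSeries.X : PowerSeries ℤ_[p]) ^ (p ^ n) - 1}) ∧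
    Nat.card (PowerSeries ℤ_[p] ⧸
        Ideal.span {(p : PowerSeries ℤ_[p]) ^ m,
          (1 + PowerSeries.X : PowerSeries ℤ_[p]) ^ (p ^ n) - 1}) = p ^ (m * p ^ n) := by
  obtain ⟨L, hL, hker⟩ := (isDistinguishedAt_one_add_X_pow_sub_one p n).exists_linearMap
  have hdeg := (monic_one_add_X_pow_sub_one p n).2
  generalize Polynomial.natDegree ((1 + Polynomial.X : Polynomial ℤ_[p]) ^ p ^ n - 1) = d
    at L hL hker hdeg
  subst hdeg
  have hcoe : (((1 + Polynomial.X : Polynomial ℤ_[p]) ^ p ^ n - 1 : Polynomial ℤ_[p]) :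
      PowerSeries ℤ_[p]) = (1 + PowerSeries.X) ^ p ^ n - 1 := by simp
  rw [hcoe] at hker
  set J := Ideal.span {(p : PowerSeries ℤ_[p]) ^ m,
    (1 + PowerSeries.X : PowerSeries ℤ_[p]) ^ p ^ n - 1} with hJ
  let φ : PowerSeries ℤ_[p] →+ (Fin (p ^ n) → ZMod (p ^ m)) :=
    ((PadicInt.toZModPow m).toAddMonoidHom.compLeft (Fin (p ^ n))).comp L.toAddMonoidHom
  have hφ (f) (i) : φ f i = PadicInt.toZModPow m (L f i) := rfl
  have hφ_surj : Function.Surjective φ :=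
    ((ZMod.ringHom_surjective (PadicInt.toZModPow m)).comp_left).comp hL
  have hsmul (f : PowerSeries ℤ_[p]) : (p : PowerSeries ℤ_[p]) ^ m * f = (p : ℤ_[p]) ^ m • f := by
    simp [Algebra.smul_def]
  have hφ_ker : φ.ker = J.toAddSubgroup := by
    ext f
    rw [AddMonoidHom.mem_ker, Submodule.mem_toAddSubgroup, hJ, Ideal.mem_span_pair]
    constructor
    · intro hf
      have hdvd (i) : ∃ c, L f i = (p : ℤ_[p]) ^ m * c := by
        rw [← dvd_def, ← Ideal.mem_span_singleton, ← PadicInt.ker_toZModPow, RingHom.mem_ker,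
          ← hφ, hf, Pi.zero_apply]
      choose c hc using hdvd
      obtain ⟨g, rfl⟩ := hL c
      have hfg : L (f - (p : ℤ_[p]) ^ m • g) = 0 := by
        ext i
        simp [hc]
      obtain ⟨b, hb⟩ := (hker _).1 hfg
      refine ⟨g, b, ?_⟩
      rw [mul_comm g, hsmul, mul_comm b, ← hb, add_sub_cancel]
    · rintro ⟨a, b, rfl⟩
      have hb := (hker (b * _)).2 (dvd_mul_left _ b)
      ext i
      rw [hφ, mul_comm a, hsmul, map_add, hb, add_zero, map_smul, Pi.smul_apply, smul_eq_mul,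
        Pi.zero_apply, ← RingHom.mem_ker, PadicInt.ker_toZModPow, Ideal.mem_span_singleton]
      exact dvd_mul_right _ _
  have e : (PowerSeries ℤ_[p] ⧸ J) ≃ (Fin (p ^ n) → ZMod (p ^ m)) :=
    ((QuotientAddGroup.quotientAddEquivOfEq hφ_ker.symm).trans
      (QuotientAddGroup.quotientKerEquivOfSurjective φ hφ_surj)).toEquiv
  have : NeZero (p ^ m) := ⟨pow_ne_zero m (Fact.out : p.Prime).ne_zero⟩
  refine ⟨Finite.of_equiv _ e.symm, ?_⟩
  rw [Nat.card_congr e, Nat.card_fun, Nat.card_zmod, Nat.card_fin, ← pow_mul]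
end
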